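/- Let V be a filled sparsity pattern on {1,…,n}. Suppose l is a proper descendant of j in the elimination tree of V and I⁺_j ⊆ I⁺_l. Then I⁺_j ⊆ I⁺_k for every vertex k on the elimination-tree path from l to j; in particular, the child k of j on this path satisfies I_k = I⁺_j and |I_j| = |I_k| − 1. -/

import Mathlib

/-- A sparsity pattern on `{1,…,n}`: a set of pairs `(i,j)` with `n ≥ i > j ≥ 1`. -/
def IsPattern (n : ℕ) (V : Finset (ℕ × ℕ)) : Prop :=
  ∀ p ∈ V, 1 ≤ p.2 ∧ p.2 < p.1 ∧ p.1 ≤ n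

/-- A pattern is filled (chordal) if `i > j > k`, `(i,k) ∈ V`, `(j,k) ∈ V` imply `(i,j) ∈ V`. -/
def IsFilled (V : Finset (ℕ × ℕ)) : Prop :=
  ∀ i j k : ℕ, k < j → j < i → (i, k) ∈ V → (j, k) ∈ V → (i, j) ∈ V

/-- `I_k = {i : i > k, (i,k) ∈ V}`. -/
def lowerNbrs (V : Finset (ℕ × ℕ)) (k : ℕ) : Finset ℕ :=
  (V.filter (fun p => p.2 = k ∧ k < p.1)).image Prod.fst

/-- `I⁺_k = {k} ∪ I_k`. -/
def lowerNbrsPlus (V : Finset (ℕ × ℕ)) (k : ℕ) : Finset ℕ :=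
  insert k (lowerNbrs V k)

/-- `j` is the parent of `k` in the elimination tree: `I_k ≠ ∅` and `j = min I_k`. -/
def ParentOf (V : Finset (ℕ × ℕ)) (j k : ℕ) : Prop :=
  j ∈ lowerNbrs V k ∧ ∀ i ∈ lowerNbrs V k, j ≤ i

/-- `j` is an ancestor of `k`: `j` is obtained from `k` by iterating the parent map
zero or more times. -/
def EtreeAncestor (V : Finset (ℕ × ℕ)) (j k : ℕ) : Prop :=
  Relation.ReflTransGen (fun a b => ParentOf V b a) k j

/-- `j` is a proper ancestor of `k`: obtained by iterating the parent map at least once. -/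
def EtreeProperAncestor (V : Finset (ℕ × ℕ)) (j k : ℕ) : Prop :=
  Relation.TransGen (fun a b => ParentOf V b a) k j

/-- A set `W` of vertices is complete for `V`: all pairs in `W` are joined in `V`. -/
def IsCompleteSet (V : Finset (ℕ × ℕ)) (W : Finset ℕ) : Prop :=
  ∀ i ∈ W, ∀ j ∈ W, j < i → (i, j) ∈ V

/-- A clique: a complete subset of `{1,…,n}` maximal with respect to inclusion. -/
def IsCliqueOf (n : ℕ) (V : Finset (ℕ × ℕ)) (W : Finset ℕ) : Prop :=
  W ⊆ Finset.Icc 1 n ∧ IsCompleteSet V W ∧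
    ∀ W' ⊆ Finset.Icc 1 n, IsCompleteSet V W' → W ⊆ W' → W = W'

theorem mem_lowerNbrs_iff (V : Finset (ℕ × ℕ)) (k i : ℕ) :
    i ∈ lowerNbrs V k ↔ (i, k) ∈ V ∧ k < i := by
  simp only [lowerNbrs, Finset.mem_image, Finset.mem_filter, Prod.exists]
  constructor
  · rintro ⟨a, b, ⟨h, rfl, h2⟩, rfl⟩
    exact ⟨h, h2⟩
  · rintro ⟨h, h2⟩
    exact ⟨i, k, ⟨h, rfl, h2⟩, rfl⟩

theorem mem_plus_iff (V : Finset (ℕ × ℕ)) (k i : ℕ) :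
    i ∈ lowerNbrsPlus V k ↔ i = k ∨ i ∈ lowerNbrs V k := by
  simp [lowerNbrsPlus]

/-- The nonminimal neighbours of a vertex are neighbours of its parent. -/
theorem lowerNbrs_subset_parent (V : Finset (ℕ × ℕ)) (hF : IsFilled V) (p k : ℕ)
    (h : ParentOf V p k) : lowerNbrs V k ⊆ lowerNbrsPlus V p := by
  intro i hi
  have hle := h.2 i hi
  have hp := (mem_lowerNbrs_iff V k p).1 h.1
  have hi' := (mem_lowerNbrs_iff V k i).1 hi
  rw [mem_plus_iff, mem_lowerNbrs_iff]
  rcases hle.eq_or_lt with h1 | h1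
  · exact Or.inl h1.symm
  · exact Or.inr ⟨hF i p k hp.2 h1 hi'.1 hp.1, h1⟩

theorem mem_plus_of_ancestor (V : Finset (ℕ × ℕ)) (hF : IsFilled V) (k l : ℕ)
    (h : EtreeAncestor V k l) :
    ∀ i ∈ lowerNbrsPlus V l, k ≤ i → i ∈ lowerNbrsPlus V k := by
  unfold EtreeAncestor at h
  induction h with
  | refl => intro i hi _; exact hi
  | @tail b c _ hbc ih =>
    intro i hi hci
    have hb := ((mem_lowerNbrs_iff V b c).1 hbc.1).2
    have := (mem_plus_iff V b i).1 (ih i hi (by omega))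
    rcases this with h1 | h1
    · omega
    · exact lowerNbrs_subset_parent V hF c b hbc h1

theorem le_of_ancestor (V : Finset (ℕ × ℕ)) (k l : ℕ)
    (h : EtreeAncestor V k l) : l ≤ k := by
  unfold EtreeAncestor at h
  induction h with
  | refl => exact le_rfl
  | @tail b c _ hbc ih =>
    have hb := ((mem_lowerNbrs_iff V b c).1 hbc.1).2
    omega

/-- If `l` is a proper descendant of `j` and `I⁺_j ⊆ I⁺_l`, then `I⁺_j ⊆ I⁺_k` for every
vertex `k` on the elimination-tree path from `l` to `j`; in particular the child `k` of `j`
on this path satisfies `I_k = I⁺_j` and `|I_j| = |I_k| − 1`. -/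
theorem stmt_10 (n : ℕ) (hn : 1 ≤ n) (V : Finset (ℕ × ℕ))
    (hV : IsPattern n V) (hF : IsFilled V) (j l : ℕ)
    (hdesc : EtreeProperAncestor V j l)
    (hsub : lowerNbrsPlus V j ⊆ lowerNbrsPlus V l) :
    (∀ k, EtreeAncestor V k l → EtreeAncestor V j k →
      lowerNbrsPlus V j ⊆ lowerNbrsPlus V k) ∧
    ∃ k, ParentOf V j k ∧ EtreeAncestor V k l ∧
      lowerNbrs V k = lowerNbrsPlus V j ∧
      ((lowerNbrs V j).card : ℤ) = ((lowerNbrs V k).card : ℤ) - 1 := by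
  have key : ∀ k, EtreeAncestor V k l → EtreeAncestor V j k →
      lowerNbrsPlus V j ⊆ lowerNbrsPlus V k := by
    intro k hk hj i hi
    have h1 := le_of_ancestor V j k hj
    refine mem_plus_of_ancestor V hF k l hk i (hsub hi) ?_
    rw [mem_plus_iff, mem_lowerNbrs_iff] at hi
    omega
  refine ⟨key, ?_⟩
  obtain ⟨k, hlk, hkj⟩ := Relation.TransGen.tail'_iff.1 hdesc
  have hlt := ((mem_lowerNbrs_iff V k j).1 hkj.1).2
  have heq : lowerNbrs V k = lowerNbrsPlus V j := by
    refine Finset.Subset.antisymm (lowerNbrs_subset_parent V hF j k hkj) ?_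
    intro i hi
    have h2 := (mem_plus_iff V k i).1 (key k hlk (Relation.ReflTransGen.single hkj) hi)
    rw [mem_plus_iff, mem_lowerNbrs_iff] at hi
    rcases h2 with h2 | h2
    · omega
    · exact h2
  refine ⟨k, hkj, hlk, heq, ?_⟩
  have hj : j ∉ lowerNbrs V j := by simp [mem_lowerNbrs_iff]
  rw [heq, lowerNbrsPlus, Finset.card_insert_of_notMem hj]
  push_cast
  ring
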